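/- Let Φ : ℝⁿ → ℝ ∪ {+∞} and g : ℝⁿ → ℝᵐ be arbitrary functions, K ⊆ ℝᵐ a closed convex cone, and suppose ξ̄ satisfies Φ(ξ̄) < +∞ and g(ξ̄) ∈ int(K) (a Slater point). Define the dual function q(y) = inf_ξ { Φ(ξ) + ⟨y, g(ξ)⟩ } for y ∈ K° and q(y) = −∞ otherwise, and let r* = inf { ⟨w, g(ξ̄)⟩ : w ∈ K*, ‖w‖ = 1 }. Assume K* ≠ {0}. Then r* > 0, and for every ȳ with q(ȳ) > −∞ and every y in the superlevel set Q_ȳ = { y : q(y) ≥ q(ȳ) }, one has ‖y‖ ≤ ( Φ(ξ̄) − q(ȳ) ) / r*; in particular Q_ȳ is bounded. -/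

import Mathlib

open scoped RealInnerProductSpace

/-- If the closed ball of radius `δ` around `x` lies in `K`, every unit vector of the dual cone
of `K` has inner product at least `δ` with `x`. -/
lemma le_inner_of_closedBall_subset {E : Type*} [NormedAddCommGroup E] [InnerProductSpace ℝ E]
    {K : Set E} {x w : E} {δ : ℝ} (hδ : 0 ≤ δ) (hball : Metric.closedBall x δ ⊆ K)
    (hw : ∀ u ∈ K, 0 ≤ ⟪w, u⟫) (hnorm : ‖w‖ = 1) : δ ≤ ⟪w, x⟫ := by
  have hmem : x - δ • w ∈ K := by
    apply hball
    simp [Metric.mem_closedBall, norm_smul, hnorm, abs_of_nonneg hδ]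
  have h := hw _ hmem
  rw [inner_sub_right, real_inner_smul_right, real_inner_self_eq_norm_sq, hnorm] at h
  linarith

/-- A lower bound on the inner products of `x` with the unit vectors of the dual cone of `K`
extends to the polar cone by homogeneity. -/
lemma mul_norm_le_neg_inner_of_mem_polar {E : Type*} [NormedAddCommGroup E]
    [InnerProductSpace ℝ E] {K : Set E} {x y : E} {r : ℝ}
    (hr : ∀ w : E, (∀ u ∈ K, 0 ≤ ⟪w, u⟫) → ‖w‖ = 1 → r ≤ ⟪w, x⟫)
    (hy : ∀ u ∈ K, ⟪y, u⟫ ≤ 0) : r * ‖y‖ ≤ -⟪y, x⟫ := by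
  rcases eq_or_ne y 0 with rfl | hy0
  · simp
  have hpos : 0 < ‖y‖ := norm_pos_iff.mpr hy0
  have h := hr (-(‖y‖⁻¹ • y))
    (fun u hu => by
      rw [inner_neg_left, real_inner_smul_left]
      have := mul_nonneg (inv_nonneg.mpr hpos.le) (neg_nonneg.mpr (hy u hu))
      linarith)
    (by rw [norm_neg, norm_smul, norm_inv, norm_norm, inv_mul_cancel₀ hpos.ne'])
  rw [inner_neg_left, real_inner_smul_left] at h
  calc r * ‖y‖ ≤ -(‖y‖⁻¹ * ⟪y, x⟫) * ‖y‖ := mul_le_mul_of_nonneg_right h hpos.le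
    _ = -⟪y, x⟫ := by field_simp

open Classical in
/-- Let `Φ : ℝⁿ → ℝ ∪ {+∞}` and `g : ℝⁿ → ℝᵐ` be arbitrary functions,
`K ⊆ ℝᵐ` a closed convex cone, and `ξ̄` a Slater point (`Φ(ξ̄) < +∞`, `g(ξ̄) ∈ int K`).
Define the dual function `q(y) = inf_ξ {Φ(ξ) + ⟨y, g(ξ)⟩}` for `y ∈ K°` and `q(y) = -∞`
otherwise, and `r* = inf {⟨w, g(ξ̄)⟩ : w ∈ K*, ‖w‖ = 1}`, assuming `K* ≠ {0}`.
Then `r* > 0` and for every `ȳ ∈ dom q` and every `y` in the superlevel set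
`Q_ȳ = {y : q(y) ≥ q(ȳ)}` one has `‖y‖ ≤ (Φ(ξ̄) − q(ȳ)) / r*`; in particular `Q_ȳ`
is bounded. -/
theorem stmt10 (n m : ℕ)
    (Φ : EuclideanSpace ℝ (Fin n) → EReal) (hΦbot : ∀ ξ, Φ ξ ≠ ⊥)
    (g : EuclideanSpace ℝ (Fin n) → EuclideanSpace ℝ (Fin m))
    (K : Set (EuclideanSpace ℝ (Fin m)))
    (hcl : IsClosed K) (hconv : Convex ℝ K)
    (hcone : ∀ t : ℝ, 0 ≤ t → ∀ x ∈ K, t • x ∈ K)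
    (hKstar : {w : EuclideanSpace ℝ (Fin m) | ∀ u ∈ K, 0 ≤ ⟪w, u⟫} ≠ {0})
    (ξbar : EuclideanSpace ℝ (Fin n)) (hΦfin : Φ ξbar ≠ ⊤)
    (hslater : g ξbar ∈ interior K) :
    -- the dual function `q`
    ∀ q : EuclideanSpace ℝ (Fin m) → EReal,
      (q = fun y => if ∀ u ∈ K, ⟪y, u⟫ ≤ 0 then
          ⨅ ξ : EuclideanSpace ℝ (Fin n), Φ ξ + ((⟪y, g ξ⟫ : ℝ) : EReal)
        else (⊥ : EReal)) →
    -- the radius `r*`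
    ∀ rstar : ℝ,
      (rstar = sInf {t : ℝ | ∃ w : EuclideanSpace ℝ (Fin m),
          (∀ u ∈ K, 0 ≤ ⟪w, u⟫) ∧ ‖w‖ = 1 ∧ t = ⟪w, g ξbar⟫}) →
    0 < rstar ∧
      ∀ ybar : EuclideanSpace ℝ (Fin m), q ybar ≠ ⊥ →
        (∀ y : EuclideanSpace ℝ (Fin m), q ybar ≤ q y →
          ‖y‖ ≤ ((Φ ξbar).toReal - (q ybar).toReal) / rstar) ∧
        Bornology.IsBounded {y : EuclideanSpace ℝ (Fin m) | q ybar ≤ q y} := by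
  intro q hq rstar hrstar
  obtain ⟨δ, hδ, hball⟩ :=
    Metric.nhds_basis_closedBall.mem_iff.mp (mem_interior_iff_mem_nhds.mp hslater)
  have hδle : ∀ w : EuclideanSpace ℝ (Fin m), (∀ u ∈ K, 0 ≤ ⟪w, u⟫) → ‖w‖ = 1 →
      δ ≤ ⟪w, g ξbar⟫ := fun w hw hn => le_inner_of_closedBall_subset hδ.le hball hw hn
  have hrle : ∀ w : EuclideanSpace ℝ (Fin m), (∀ u ∈ K, 0 ≤ ⟪w, u⟫) → ‖w‖ = 1 →
      rstar ≤ ⟪w, g ξbar⟫ := by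
    intro w hw hn
    rw [hrstar]
    refine csInf_le ⟨δ, ?_⟩ ⟨w, hw, hn, rfl⟩
    rintro t ⟨v, hv, hvn, rfl⟩
    exact hδle v hv hvn
  have hpos : 0 < rstar := by
    obtain ⟨w, hw, hw0⟩ : ∃ w : EuclideanSpace ℝ (Fin m), (∀ u ∈ K, 0 ≤ ⟪w, u⟫) ∧ w ≠ 0 := by
      by_contra! hcon
      refine hKstar (Set.eq_singleton_iff_unique_mem.mpr ⟨?_, hcon⟩)
      simp
    have hwpos : 0 < ‖w‖ := norm_pos_iff.mpr hw0
    refine hδ.trans_le ?_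
    rw [hrstar]
    refine le_csInf ⟨_, ‖w‖⁻¹ • w, fun u hu => ?_, ?_, rfl⟩ ?_
    · rw [real_inner_smul_left]
      exact mul_nonneg (inv_nonneg.mpr hwpos.le) (hw u hu)
    · rw [norm_smul, norm_inv, norm_norm, inv_mul_cancel₀ hwpos.ne']
    · rintro t ⟨v, hv, hvn, rfl⟩
      exact hδle v hv hvn
  refine ⟨hpos, fun ybar hybar => ?_⟩
  have hbound : ∀ y : EuclideanSpace ℝ (Fin m), q ybar ≤ q y →
      ‖y‖ ≤ ((Φ ξbar).toReal - (q ybar).toReal) / rstar := by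
    intro y hy
    have hpolar : ∀ u ∈ K, ⟪y, u⟫ ≤ 0 := by
      by_contra hcon
      refine hybar (le_bot_iff.mp (hy.trans_eq ?_))
      simp only [hq, if_neg hcon]
    have hle : q ybar ≤ Φ ξbar + ((⟪y, g ξbar⟫ : ℝ) : EReal) := by
      refine hy.trans ?_
      simp only [hq, if_pos hpolar]
      exact iInf_le _ ξbar
    rw [← EReal.coe_toReal hΦfin (hΦbot ξbar), ← EReal.coe_add] at hle
    have hle' : (q ybar).toReal ≤ (Φ ξbar).toReal + ⟪y, g ξbar⟫ :=
      EReal.toReal_le_toReal hle hybar (EReal.coe_ne_top _)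
    have hmul := mul_norm_le_neg_inner_of_mem_polar hrle hpolar
    rw [le_div_iff₀ hpos]
    linarith
  exact ⟨hbound, isBounded_iff_forall_norm_le.mpr ⟨_, hbound⟩⟩
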